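/- arXiv:1912.07920 — 3 statements merged into one kernel-verified Lean document; each statement's English description precedes it below -/
import Mathlib

section
/- Every p-primitive class in F^{(Dp²,rp)}_{D₀,r₀}(N) contains a representative [a,b,c] with p ∣ b and p ∤ c. Consequently, the subset P^{(Dp²,rp)}_{D₀,r₀}(N) of classes represented by a form with p ∤ c coincides with the set of p-primitive classes in F^{(Dp²,rp)}_{D₀,r₀}(N). -/
open Matrix

abbrev SL2Z := Matrix.SpecialLinearGroup (Fin 2) ℤ

/-- An integral binary quadratic form `[a,b,c] = a x² + b x y + c y²`. -/
@[ext]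
structure QF where
  a : ℤ
  b : ℤ
  c : ℤ

/-- Right action of `SL₂(ℤ)` on binary quadratic forms:
`(Q|γ)(x,y) = Q(Ax + By, Cx + Dy)` for `γ = [[A,B],[C,D]]`. -/
def QF.act (Q : QF) (γ : SL2Z) : QF where
  a := Q.a * (γ.1 0 0)^2 + Q.b * (γ.1 0 0 * γ.1 1 0) + Q.c * (γ.1 1 0)^2
  b := 2 * Q.a * (γ.1 0 0 * γ.1 0 1) + Q.b * (γ.1 0 0 * γ.1 1 1 + γ.1 0 1 * γ.1 1 0)
        + 2 * Q.c * (γ.1 1 0 * γ.1 1 1)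
  c := Q.a * (γ.1 0 1)^2 + Q.b * (γ.1 0 1 * γ.1 1 1) + Q.c * (γ.1 1 1)^2

lemma QF.act_one (Q : QF) : Q.act 1 = Q := by
  ext <;> simp [QF.act, Matrix.SpecialLinearGroup.coe_one, Matrix.one_apply]

lemma QF.act_mul (Q : QF) (γ γ' : SL2Z) : Q.act (γ * γ') = (Q.act γ).act γ' := by
  have h : ∀ i j, ((γ * γ' : SL2Z) : Matrix (Fin 2) (Fin 2) ℤ) i j
      = γ.1 i 0 * γ'.1 0 j + γ.1 i 1 * γ'.1 1 j := by
    intro i j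
    rw [Matrix.SpecialLinearGroup.coe_mul, Matrix.mul_apply, Fin.sum_univ_two]
  ext <;> simp only [QF.act, h] <;> ring

lemma SL2Z_inv_entry (γ : SL2Z) : (γ⁻¹).1 1 0 = - γ.1 1 0 := by
  rw [Matrix.SpecialLinearGroup.SL2_inv_expl]
  simp

/-- `Γ₀(M)`-equivalence of binary quadratic forms. -/
def Gamma0Equiv (M : ℤ) (Q Q' : QF) : Prop :=
  ∃ γ : SL2Z, M ∣ γ.1 1 0 ∧ Q.act γ = Q'

/-- `Γ₀(M)`-equivalence is an equivalence relation. -/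
def gammaSetoid (M : ℤ) : Setoid QF where
  r := Gamma0Equiv M
  iseqv := by
    constructor
    · intro Q
      refine ⟨1, ?_, QF.act_one Q⟩
      simp [Matrix.SpecialLinearGroup.coe_one, Matrix.one_apply]
    · rintro Q Q' ⟨γ, hd, rfl⟩
      refine ⟨γ⁻¹, by rw [SL2Z_inv_entry]; exact hd.neg_right, ?_⟩
      rw [← QF.act_mul, mul_inv_cancel, QF.act_one]
    · rintro Q Q' Q'' ⟨γ, hd, rfl⟩ ⟨γ', hd', rfl⟩
      refine ⟨γ * γ', ?_, QF.act_mul Q γ γ'⟩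
      have h : ((γ * γ' : SL2Z) : Matrix (Fin 2) (Fin 2) ℤ) 1 0
          = γ.1 1 0 * γ'.1 0 0 + γ.1 1 1 * γ'.1 1 0 := by
        rw [Matrix.SpecialLinearGroup.coe_mul, Matrix.mul_apply, Fin.sum_univ_two]
      rw [h]
      exact dvd_add (hd.mul_right _) (hd'.mul_left _)

/-- The set of `Γ₀(M)`-equivalence classes of integral binary quadratic forms. -/
abbrev QFClass (M : ℤ) := Quotient (gammaSetoid M)

/-- The `Γ₀(M)`-equivalence class of a form. -/
def QFClass.mk (M : ℤ) (Q : QF) : QFClass M := Quotient.mk (gammaSetoid M) Q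

/-- The discriminant `b² - 4ac` of a binary quadratic form. -/
def QF.disc (Q : QF) : ℤ := Q.b^2 - 4 * Q.a * Q.c

/-- The defining conditions for membership in `F^{(D',r')}_{D₀,r₀}(N, p^s)`:
discriminant `p^{2s} D₀ D'`, `b ≡ -p^s r₀ r' (mod 2N)` and `a ≡ 0 (mod N p^{2s})`. -/
def memF (N p : ℤ) (s : ℕ) (D₀ r₀ D' r' : ℤ) (Q : QF) : Prop :=
  Q.disc = p^(2*s) * D₀ * D' ∧ (2*N) ∣ (Q.b + p^s * r₀ * r') ∧ (N * p^(2*s)) ∣ Q.a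

/-- The set `F^{(D',r')}_{D₀,r₀}(N, p^s)` of `Γ₀(M)`-classes (`M = N p^s`) of forms
satisfying the conditions `memF`. -/
def Fclasses (M N p : ℤ) (s : ℕ) (D₀ r₀ D' r' : ℤ) : Set (QFClass M) :=
  {cl | ∃ Q : QF, QFClass.mk M Q = cl ∧ memF N p s D₀ r₀ D' r' Q}

/-- The subset `P^{(D',r')}_{D₀,r₀}(N, p^s)` of `F^{(D',r')}_{D₀,r₀}(N, p^s)` of classes
represented by a form `[a,b,c]` with `p ∤ c`. -/
def Pclasses (M N p : ℤ) (s : ℕ) (D₀ r₀ D' r' : ℤ) : Set (QFClass M) :=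
  {cl | cl ∈ Fclasses M N p s D₀ r₀ D' r' ∧ ∃ Q : QF, QFClass.mk M Q = cl ∧ ¬ p ∣ Q.c}

/-- A form `[a,b,c]` is `p`-primitive if `p ∤ gcd(a,b,c)`. -/
def QF.pPrimitive (p : ℤ) (Q : QF) : Prop := ¬ (p ∣ Q.a ∧ p ∣ Q.b ∧ p ∣ Q.c)

/-- A class is `p`-primitive if it contains a `p`-primitive form. -/
def pPrimClass (M p : ℤ) (cl : QFClass M) : Prop :=
  ∃ Q : QF, QFClass.mk M Q = cl ∧ Q.pPrimitive p

/-- `(D, r)` is an index `N` pair: `D < 0` and `D ≡ r² (mod 4N)`. -/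
def IsIndexPair (N D r : ℤ) : Prop := D < 0 ∧ (4*N) ∣ (r^2 - D)

/-- `D` is a fundamental discriminant. -/
def IsFundamentalDiscriminant (D : ℤ) : Prop :=
  (D % 4 = 1 ∧ Squarefree D) ∨
    (D % 4 = 0 ∧ Squarefree (D / 4) ∧ (D / 4 % 4 = 2 ∨ D / 4 % 4 = 3))

/-- The map on classes induced by coarsening the level `M` to a divisor `M'`. -/
def coarsen (M M' : ℤ) (h : M' ∣ M) : QFClass M → QFClass M' :=
  Quotient.lift (QFClass.mk M') (by
    rintro Q Q' ⟨γ, hd, hact⟩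
    exact Quotient.sound ⟨γ, h.trans hd, hact⟩)

lemma Matrix.SpecialLinearGroup.det_fin_two_entries (γ : SL2Z) :
    γ.1 0 0 * γ.1 1 1 - γ.1 0 1 * γ.1 1 0 = 1 := by
  rw [← Matrix.det_fin_two]
  exact γ.2

lemma QF.disc_act (Q : QF) (γ : SL2Z) : (Q.act γ).disc = Q.disc := by
  have h := Matrix.SpecialLinearGroup.det_fin_two_entries γ
  have key : (Q.act γ).disc =
      Q.disc * (γ.1 0 0 * γ.1 1 1 - γ.1 0 1 * γ.1 1 0) ^ 2 := by
    simp only [QF.disc, QF.act]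
    ring
  rw [key, h]
  ring

/-- Membership in `F^{(D',r')}_{D₀,r₀}(N)` is invariant under `Γ₀(N)`. -/
lemma memF.act {N p D₀ r₀ D' r' : ℤ} {Q : QF} (hQ : memF N p 0 D₀ r₀ D' r' Q)
    {γ : SL2Z} (hγ : N ∣ γ.1 1 0) : memF N p 0 D₀ r₀ D' r' (Q.act γ) := by
  obtain ⟨hdisc, hb, ha⟩ := hQ
  have hdet := Matrix.SpecialLinearGroup.det_fin_two_entries γ
  refine ⟨by rw [QF.disc_act, hdisc], ?_, ?_⟩
  · simp only [mul_zero, pow_zero, mul_one, one_mul] at ha hb ⊢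
    obtain ⟨x, hx⟩ := ha
    obtain ⟨y, hy⟩ := hb
    obtain ⟨z, hz⟩ := hγ
    refine ⟨x * γ.1 0 0 * γ.1 0 1 + Q.b * γ.1 0 1 * z + Q.c * z * γ.1 1 1 + y, ?_⟩
    simp only [QF.act, hx, hz] at hdet ⊢
    linear_combination Q.b * hdet + hy
  · simp only [mul_zero, pow_zero, mul_one] at ha ⊢
    exact dvd_add (dvd_add (ha.mul_right _) ((hγ.mul_left _).mul_left _))
      ((dvd_pow hγ two_ne_zero).mul_left _)

lemma QFClass.mk_act {M : ℤ} (Q : QF) {γ : SL2Z} (hγ : M ∣ γ.1 1 0) :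
    QFClass.mk M (Q.act γ) = QFClass.mk M Q :=
  (Quotient.sound (s := gammaSetoid M) ⟨γ, hγ, rfl⟩).symm

lemma memF_of_mk_mem_Fclasses {N p D₀ r₀ D' r' : ℤ} {Q : QF}
    (h : QFClass.mk N Q ∈ Fclasses N N p 0 D₀ r₀ D' r') : memF N p 0 D₀ r₀ D' r' Q := by
  obtain ⟨Q', hmk, hQ'⟩ := h
  obtain ⟨γ, hγ, rfl⟩ := Quotient.exact hmk
  exact hQ'.act hγ

/-- The lower triangular matrix `[[1,0],[t,1]]`. -/
def lowerUnipotent (t : ℤ) : SL2Z := ⟨!![1, 0; t, 1], by simp [Matrix.det_fin_two]⟩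

/-- The upper triangular matrix `[[1,t],[0,1]]`. -/
def upperUnipotent (t : ℤ) : SL2Z := ⟨!![1, t; 0, 1], by simp [Matrix.det_fin_two]⟩

/-- If `p` divides the discriminant of a `p`-primitive form, some `Γ₀(M)`-equivalent form has
last coefficient prime to `p`. -/
lemma QF.pPrimitive.exists_act_not_dvd_c {p : ℤ} (hp : Prime p) {Q : QF}
    (hprim : Q.pPrimitive p) (hdisc : p ∣ Q.disc) (M : ℤ) :
    ∃ γ : SL2Z, M ∣ γ.1 1 0 ∧ ¬ p ∣ (Q.act γ).c := by
  by_cases hc : p ∣ Q.c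
  · have hb : p ∣ Q.b := by
      refine hp.dvd_of_dvd_pow (n := 2) ?_
      have h := dvd_add hdisc (hc.mul_left (4 * Q.a))
      rwa [QF.disc, sub_add_cancel] at h
    have ha : ¬ p ∣ Q.a := fun ha => hprim ⟨ha, hb, hc⟩
    refine ⟨upperUnipotent 1, by simp [upperUnipotent], fun h => ha ?_⟩
    have h' : p ∣ Q.a + Q.b + Q.c := by simpa [QF.act, upperUnipotent] using h
    exact (dvd_add_left hb).1 ((dvd_add_left hc).1 h')
  · exact ⟨1, by simp, by rwa [QF.act_one]⟩

/-- If `p ∤ c` and `p ∤ 2M`, some `Γ₀(M)`-equivalent form has the same last coefficient and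
middle coefficient divisible by `p`. -/
lemma QF.exists_act_dvd_b {p M : ℤ} (hp : Prime p) (hp2 : ¬ p ∣ 2) (hpM : ¬ p ∣ M) {Q : QF}
    (hc : ¬ p ∣ Q.c) :
    ∃ γ : SL2Z, M ∣ γ.1 1 0 ∧ p ∣ (Q.act γ).b ∧ (Q.act γ).c = Q.c := by
  have hcop : IsCoprime p (2 * Q.c * M) := by
    rw [hp.coprime_iff_not_dvd]
    exact hp.not_dvd_mul (hp.not_dvd_mul hp2 hc) hpM
  obtain ⟨u, v, huv⟩ := hcop
  refine ⟨lowerUnipotent (M * (-v * Q.b)), by simp [lowerUnipotent], ⟨u * Q.b, ?_⟩, ?_⟩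
  · simp [QF.act, lowerUnipotent]
    linear_combination -Q.b * huv
  · simp [QF.act, lowerUnipotent]

lemma QF.pPrimitive.exists_good_act {p M : ℤ} (hp : Prime p) (hp2 : ¬ p ∣ 2) (hpM : ¬ p ∣ M)
    {Q : QF} (hprim : Q.pPrimitive p) (hdisc : p ∣ Q.disc) :
    ∃ Q' : QF, Gamma0Equiv M Q Q' ∧ p ∣ Q'.b ∧ ¬ p ∣ Q'.c := by
  obtain ⟨γ, hγ, hc⟩ := hprim.exists_act_not_dvd_c hp hdisc M
  obtain ⟨δ, hδ, hb, hc'⟩ := QF.exists_act_dvd_b hp hp2 hpM hc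
  exact ⟨_, (gammaSetoid M).trans ⟨γ, hγ, rfl⟩ ⟨δ, hδ, rfl⟩, hb, by rwa [hc']⟩

/-- Every `p`-primitive class in `F^{(Dp²,rp)}_{D₀,r₀}(N)` contains a
representative `[a,b,c]` with `p ∣ b` and `p ∤ c`; consequently `P^{(Dp²,rp)}_{D₀,r₀}(N)`
coincides with the set of `p`-primitive classes in `F^{(Dp²,rp)}_{D₀,r₀}(N)`. -/
theorem primitive_classes_have_good_reps
    (N p D₀ r₀ D r : ℤ) (hN : 1 ≤ N) (hNodd : Odd N)
    (hp : Prime p) (hp5 : 5 ≤ p) (hpN : ¬ p ∣ N)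
    (hD₀ : IsIndexPair N D₀ r₀) (hfund : IsFundamentalDiscriminant D₀)
    (hD : IsIndexPair N D r) :
    (∀ cl ∈ Fclasses N N p 0 D₀ r₀ (D * p^2) (r * p), pPrimClass N p cl →
      ∃ Q : QF, QFClass.mk N Q = cl ∧ memF N p 0 D₀ r₀ (D * p^2) (r * p) Q ∧
        p ∣ Q.b ∧ ¬ p ∣ Q.c) ∧
    Pclasses N N p 0 D₀ r₀ (D * p^2) (r * p)
      = {cl ∈ Fclasses N N p 0 D₀ r₀ (D * p^2) (r * p) | pPrimClass N p cl} := by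
  have hp2 : ¬ p ∣ 2 := fun h => by
    have := Int.le_of_dvd two_pos h
    omega
  have good : ∀ cl ∈ Fclasses N N p 0 D₀ r₀ (D * p^2) (r * p), pPrimClass N p cl →
      ∃ Q : QF, QFClass.mk N Q = cl ∧ memF N p 0 D₀ r₀ (D * p^2) (r * p) Q ∧
        p ∣ Q.b ∧ ¬ p ∣ Q.c := by
    rintro _ hF ⟨Q, rfl, hprim⟩
    have hQ := memF_of_mk_mem_Fclasses hF
    have hdisc : p ∣ Q.disc := by
      rw [hQ.1]
      exact ((dvd_pow_self p two_ne_zero).mul_left D).mul_left _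
    obtain ⟨_, ⟨γ, hγ, rfl⟩, hb, hc⟩ := hprim.exists_good_act hp hp2 hpN hdisc
    exact ⟨_, QFClass.mk_act Q hγ, hQ.act hγ, hb, hc⟩
  refine ⟨good, Set.ext fun cl => ⟨?_, ?_⟩⟩
  · rintro ⟨hF, Q, hmk, hc⟩
    exact ⟨hF, Q, hmk, fun h => hc h.2.2⟩
  · rintro ⟨hF, hprim⟩
    obtain ⟨Q, hmk, -, -, hc⟩ := good cl hF hprim
    exact ⟨hF, Q, hmk, hc⟩
end

section
/- Let s ≥ 1. Every integral binary quadratic form [a,b,c] satisfying b² − 4ac = p^{2s} D₀ D, b ≡ −p^s r₀ r (mod 2N), a ≡ 0 (mod Np^{2s}) and p ∤ c also satisfies the defining conditions of F^{(Dp^{2(s−1)}, rp^{s−1})}_{D₀,r₀}(N,p), and the assignment sending the Γ₀(Np^s)-equivalence class of such a form to its Γ₀(Np)-equivalence class defines a bijection from P^{(D,r)}_{D₀,r₀}(N,p^s) onto P^{(Dp^{2(s−1)}, rp^{s−1})}_{D₀,r₀}(N,p). -/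
open Matrix

lemma QFClass.mk_eq_iff {M : ℤ} {Q Q' : QF} :
    QFClass.mk M Q = QFClass.mk M Q' ↔ Gamma0Equiv M Q Q' :=
  Quotient.eq (r := gammaSetoid M)

/-- A form satisfying `memF` at level `s` has middle coefficient divisible by `p^s`. -/
lemma memF.pow_dvd_b {N p D₀ r₀ D r : ℤ} {s : ℕ} {Q : QF} (h : memF N p s D₀ r₀ D r Q) :
    p ^ s ∣ Q.b := by
  obtain ⟨hdisc, -, ha⟩ := h
  rw [← Int.pow_dvd_pow_iff two_ne_zero, ← pow_mul, mul_comm s 2]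
  have hb : Q.b ^ 2 = p ^ (2 * s) * (D₀ * D) + Q.a * (4 * Q.c) := by
    rw [QF.disc] at hdisc
    linear_combination hdisc
  rw [hb]
  exact dvd_add (dvd_mul_right _ _) (((dvd_mul_left _ _).trans ha).mul_right _)

lemma Prime.isCoprime_pow_of_not_dvd {p x : ℤ} (hp : Prime p) (h : ¬ p ∣ x) (s : ℕ) :
    IsCoprime (p ^ s) x :=
  (hp.irreducible.coprime_iff_not_dvd.mpr h).pow_left

lemma not_dvd_two_of_five_le {p : ℤ} (hp5 : 5 ≤ p) : ¬ p ∣ 2 := fun h => by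
  have := Int.le_of_dvd two_pos h
  omega

/-- The condition `p ∤ c` defining `Pclasses` may be imposed on the form satisfying `memF`. -/
lemma mem_Pclasses_iff {M N p D₀ r₀ D r : ℤ} {s : ℕ} (hs : 1 ≤ s) {cl : QFClass M} :
    cl ∈ Pclasses M N p s D₀ r₀ D r ↔
      ∃ Q : QF, QFClass.mk M Q = cl ∧ memF N p s D₀ r₀ D r Q ∧ ¬ p ∣ Q.c := by
  constructor
  · rintro ⟨⟨Q, rfl, hQ⟩, Q', hQ', hc⟩
    refine ⟨Q, rfl, hQ, fun h => hc ?_⟩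
    obtain ⟨γ, -, rfl⟩ := QFClass.mk_eq_iff.mp hQ'.symm
    have ha : p ∣ Q.a :=
      ((dvd_pow_self p (by omega)).trans (dvd_mul_left _ _)).trans hQ.2.2
    have hb : p ∣ Q.b := (dvd_pow_self p (by omega)).trans hQ.pow_dvd_b
    exact dvd_add (dvd_add (ha.mul_right _) (hb.mul_right _)) (h.mul_right _)
  · rintro ⟨Q, rfl, hQ, hc⟩
    exact ⟨⟨Q, rfl, hQ⟩, Q, rfl, hc⟩

lemma memF.to_level_one {N p D₀ r₀ D r : ℤ} {s : ℕ} (hs : 1 ≤ s) {Q : QF}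
    (h : memF N p s D₀ r₀ D r Q) :
    memF N p 1 D₀ r₀ (D * p ^ (2 * (s - 1))) (r * p ^ (s - 1)) Q := by
  obtain ⟨t, rfl⟩ := Nat.exists_eq_add_of_le' hs
  obtain ⟨hdisc, hb, ha⟩ := h
  simp only [Nat.add_sub_cancel]
  refine ⟨by rw [hdisc]; ring, ?_, ?_⟩
  · convert hb using 2
    ring
  · exact (mul_dvd_mul_left N (pow_dvd_pow p (by omega))).trans ha

/-- A matrix carrying a form satisfying `memF` at level `s` with `p ∤ c` to another form
satisfying `memF` has lower-left entry divisible by `p^s`. -/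
lemma memF.pow_dvd_lower_left {N p D₀ r₀ D r : ℤ} {s : ℕ} (hp : Prime p) (hp5 : 5 ≤ p)
    {Q : QF} {γ : SL2Z} (h : memF N p s D₀ r₀ D r Q) (hc : ¬ p ∣ Q.c)
    (h' : memF N p s D₀ r₀ D r (Q.act γ)) : p ^ s ∣ γ.1 1 0 := by
  have hb := h.pow_dvd_b
  have ha : p ^ (2 * s) ∣ Q.a := (dvd_mul_left _ _).trans h.2.2
  have ha' : p ^ (2 * s) ∣ (Q.act γ).a := (dvd_mul_left _ _).trans h'.2.2
  have hb2 : p ^ (2 * s) ∣ Q.b ^ 2 := by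
    rw [mul_comm, pow_mul]
    exact pow_dvd_pow_of_dvd hb 2
  have hsq : p ^ (2 * s) ∣ (2 * Q.c * γ.1 1 0 + Q.b * γ.1 0 0) ^ 2 := by
    have e : (2 * Q.c * γ.1 1 0 + Q.b * γ.1 0 0) ^ 2
        = (Q.act γ).a * (4 * Q.c) - Q.a * (4 * Q.c * γ.1 0 0 ^ 2)
          + Q.b ^ 2 * γ.1 0 0 ^ 2 := by
      simp only [QF.act]
      ring
    rw [e]
    exact dvd_add (dvd_sub (ha'.mul_right _) (ha.mul_right _)) (hb2.mul_right _)
  rw [mul_comm, pow_mul, Int.pow_dvd_pow_iff two_ne_zero] at hsq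
  have h2c : p ^ s ∣ 2 * Q.c * γ.1 1 0 := (dvd_add_left (hb.mul_right _)).mp hsq
  refine (hp.isCoprime_pow_of_not_dvd (fun hd => ?_) s).dvd_of_dvd_mul_left h2c
  exact (hp.dvd_or_dvd hd).elim (not_dvd_two_of_five_le hp5) hc

/-- Every form at level `Np` with `p ∤ c` is `Γ₀(Np)`-equivalent to one satisfying `memF` at
level `Np^s`. -/
lemma memF.exists_act_of_level_one {N p D₀ r₀ D r : ℤ} {s : ℕ} (hs : 1 ≤ s) (hp : Prime p)
    (hp5 : 5 ≤ p) (hpN : ¬ p ∣ N) {Q : QF}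
    (h : memF N p 1 D₀ r₀ (D * p ^ (2 * (s - 1))) (r * p ^ (s - 1)) Q) (hc : ¬ p ∣ Q.c) :
    ∃ γ : SL2Z, N * p ∣ γ.1 1 0 ∧ memF N p s D₀ r₀ D r (Q.act γ) ∧ ¬ p ∣ (Q.act γ).c := by
  have hpb : p ∣ Q.b := by simpa using h.pow_dvd_b
  obtain ⟨hdisc, hb, ha⟩ := h
  have hdisc' : Q.disc = p ^ (2 * s) * D₀ * D := by
    obtain ⟨t, rfl⟩ := Nat.exists_eq_add_of_le' hs
    rw [hdisc, Nat.add_sub_cancel]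
    ring
  have hb' : 2 * N ∣ Q.b + p ^ s * r₀ * r := by
    obtain ⟨t, rfl⟩ := Nat.exists_eq_add_of_le' hs
    convert hb using 2
    rw [Nat.add_sub_cancel]
    ring
  have hp2 := not_dvd_two_of_five_le hp5
  have h2cN : ¬ p ∣ 2 * Q.c * N := fun hd =>
    (hp.dvd_or_dvd hd).elim (fun hd => (hp.dvd_or_dvd hd).elim hp2 hc) hpN
  obtain ⟨u, v, huv⟩ := hp.isCoprime_pow_of_not_dvd h2cN s
  set k : ℤ := -(v * Q.b) with hk
  let γ : SL2Z := ⟨!![1, 0; N * k, 1], by simp [Matrix.det_fin_two]⟩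
  have h00 : γ.1 0 0 = 1 := rfl
  have h01 : γ.1 0 1 = 0 := rfl
  have h10 : γ.1 1 0 = N * k := rfl
  have h11 : γ.1 1 1 = 1 := rfl
  have eb : (Q.act γ).b = Q.b + 2 * N * (Q.c * k) := by
    simp only [QF.act, h00, h01, h10, h11]
    ring
  have ec : (Q.act γ).c = Q.c := by
    simp only [QF.act, h01, h11]
    ring
  have ea : (Q.act γ).a = Q.a + N * (Q.b * k + Q.c * N * k ^ 2) := by
    simp only [QF.act, h00, h10]
    ring
  refine ⟨γ, ?_, ⟨(Q.disc_act γ).trans hdisc', ?_, ?_⟩, by rwa [ec]⟩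
  · rw [h10]
    exact mul_dvd_mul_left N (dvd_neg.mpr (hpb.mul_left v))
  · rw [eb, add_right_comm]
    exact dvd_add hb' (dvd_mul_right _ _)
  · have hbs : p ^ s ∣ (Q.act γ).b :=
      ⟨u * Q.b, by rw [eb, hk]; linear_combination (-Q.b) * huv⟩
    have hpa : p ^ (2 * s) ∣ 4 * Q.c * (Q.act γ).a := by
      have e : 4 * Q.c * (Q.act γ).a = (Q.act γ).b ^ 2 - p ^ (2 * s) * (D₀ * D) := by
        have hd := (Q.disc_act γ).trans hdisc'
        rw [QF.disc, ec] at hd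
        linear_combination -hd
      rw [e, mul_comm 2 s, pow_mul]
      exact dvd_sub (pow_dvd_pow_of_dvd hbs 2) (dvd_mul_right _ _)
    have h4c : ¬ p ∣ 4 * Q.c := fun hd => by
      rw [show (4 : ℤ) = 2 * 2 by norm_num] at hd
      exact (hp.dvd_or_dvd hd).elim (fun hd => (hp.dvd_or_dvd hd).elim hp2 hp2) hc
    refine (hp.isCoprime_pow_of_not_dvd hpN _).symm.mul_dvd ?_ ?_
    · rw [ea]
      exact dvd_add ((dvd_mul_right _ _).trans ha) (dvd_mul_right _ _)
    · exact (hp.isCoprime_pow_of_not_dvd h4c _).dvd_of_dvd_mul_left hpa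

/-- For `s ≥ 1`, every form `[a,b,c]` with `b² - 4ac = p^{2s} D₀ D`,
`b ≡ -p^s r₀ r (mod 2N)`, `a ≡ 0 (mod N p^{2s})` and `p ∤ c` also satisfies the defining
conditions of `F^{(Dp^{2(s-1)}, rp^{s-1})}_{D₀,r₀}(N,p)`, and sending the `Γ₀(Np^s)`-class
of such a form to its `Γ₀(Np)`-class is a bijection from `P^{(D,r)}_{D₀,r₀}(N,p^s)` onto
`P^{(Dp^{2(s-1)}, rp^{s-1})}_{D₀,r₀}(N,p)`. -/
theorem classes_bijection_level_ps
    (N p D₀ r₀ D r : ℤ) (s : ℕ) (hs : 1 ≤ s) (hN : 1 ≤ N) (hNodd : Odd N)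
    (hp : Prime p) (hp5 : 5 ≤ p) (hpN : ¬ p ∣ N)
    (hD₀ : IsIndexPair N D₀ r₀) (hfund : IsFundamentalDiscriminant D₀)
    (hD : IsIndexPair N D r) :
    (∀ Q : QF, memF N p s D₀ r₀ D r Q → ¬ p ∣ Q.c →
      memF N p 1 D₀ r₀ (D * p^(2*(s-1))) (r * p^(s-1)) Q) ∧
    Set.BijOn
      (coarsen (N * p^s) (N * p)
        (mul_dvd_mul_left N (dvd_pow_self p (Nat.one_le_iff_ne_zero.mp hs))))
      (Pclasses (N * p^s) N p s D₀ r₀ D r)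
      (Pclasses (N * p) N p 1 D₀ r₀ (D * p^(2*(s-1))) (r * p^(s-1))) := by
  refine ⟨fun Q hQ _ => hQ.to_level_one hs, ?_, ?_, ?_⟩
  · intro cl hcl
    obtain ⟨Q, rfl, hQ, hc⟩ := (mem_Pclasses_iff hs).mp hcl
    exact (mem_Pclasses_iff le_rfl).mpr ⟨Q, rfl, hQ.to_level_one hs, hc⟩
  · intro cl hcl cl' hcl' heq
    obtain ⟨Q, rfl, hQ, hc⟩ := (mem_Pclasses_iff hs).mp hcl
    obtain ⟨Q', rfl, hQ', -⟩ := (mem_Pclasses_iff hs).mp hcl'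
    obtain ⟨γ, hγ, rfl⟩ := QFClass.mk_eq_iff.mp heq
    refine QFClass.mk_eq_iff.mpr ⟨γ, ?_, rfl⟩
    exact (hp.isCoprime_pow_of_not_dvd hpN s).symm.mul_dvd ((dvd_mul_right _ _).trans hγ)
      (hQ.pow_dvd_lower_left hp hp5 hc hQ')
  · intro cl hcl
    obtain ⟨Q, rfl, hQ, hc⟩ := (mem_Pclasses_iff le_rfl).mp hcl
    obtain ⟨γ, hγ, hmem, hc'⟩ := hQ.exists_act_of_level_one hs hp hp5 hpN hc
    exact ⟨QFClass.mk _ (Q.act γ), (mem_Pclasses_iff hs).mpr ⟨_, rfl, hmem, hc'⟩,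
      (QFClass.mk_eq_iff.mpr ⟨γ, hγ, rfl⟩).symm⟩
end

section
/- Assume in addition that p ∤ D₀·D. Then the map [a,b,c] ↦ [pa, pb, pc] induces a well-defined bijection from the set of Γ₀(Np)-equivalence classes of integral binary quadratic forms [a,b,c] with b² − 4ac = D₀D, b ≡ −r₀r (mod 2N) and a ≡ 0 (mod Np), onto the set of non-p-primitive classes in F^{(D,r)}_{D₀,r₀}(N,p). -/
open Matrix

/-- Multiplying all coefficients of a form by `k`. -/
def QF.scale (k : ℤ) (Q : QF) : QF := ⟨k * Q.a, k * Q.b, k * Q.c⟩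

lemma QF.scale_act (k : ℤ) (Q : QF) (γ : SL2Z) :
    (Q.scale k).act γ = (Q.act γ).scale k := by
  ext <;> simp only [QF.act, QF.scale] <;> ring

/-- The map on `Γ₀(M)`-classes induced by `[a,b,c] ↦ [ka, kb, kc]`. -/
def scaleClass (M k : ℤ) : QFClass M → QFClass M :=
  Quotient.map (QF.scale k) (by
    rintro Q Q' ⟨γ, hd, rfl⟩
    exact ⟨γ, hd, QF.scale_act k Q γ⟩)

lemma QF.scale_injective {k : ℤ} (hk : k ≠ 0) : Function.Injective (QF.scale k) := by
  intro Q Q' h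
  simp only [QF.scale, QF.mk.injEq] at h
  exact QF.ext (mul_left_cancel₀ hk h.1) (mul_left_cancel₀ hk h.2.1) (mul_left_cancel₀ hk h.2.2)

lemma QF.disc_scale (k : ℤ) (Q : QF) : (Q.scale k).disc = k ^ 2 * Q.disc := by
  simp only [QF.disc, QF.scale]
  ring

lemma QF.not_pPrimitive_iff {p : ℤ} {Q : QF} :
    ¬ Q.pPrimitive p ↔ ∃ Q' : QF, Q'.scale p = Q := by
  rw [QF.pPrimitive, not_not]
  constructor
  · rintro ⟨⟨a, ha⟩, ⟨b, hb⟩, ⟨c, hc⟩⟩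
    exact ⟨⟨a, b, c⟩, QF.ext ha.symm hb.symm hc.symm⟩
  · rintro ⟨Q', rfl⟩
    exact ⟨dvd_mul_right _ _, dvd_mul_right _ _, dvd_mul_right _ _⟩

lemma scaleClass_injective (M : ℤ) {k : ℤ} (hk : k ≠ 0) :
    Function.Injective (scaleClass M k) := by
  rintro ⟨Q⟩ ⟨Q'⟩ h
  obtain ⟨γ, hγ, hact⟩ : Gamma0Equiv M (Q.scale k) (Q'.scale k) := Quotient.exact h
  rw [QF.scale_act] at hact
  exact Quotient.sound ⟨γ, hγ, QF.scale_injective hk hact⟩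

lemma not_pPrimClass_scaleClass (M p : ℤ) (cl : QFClass M) :
    ¬ pPrimClass M p (scaleClass M p cl) := by
  rcases cl with ⟨Q⟩
  rintro ⟨Q', hQ', hprim⟩
  obtain ⟨γ, -, rfl⟩ : Gamma0Equiv M (Q.scale p) Q' := Quotient.exact hQ'.symm
  exact QF.not_pPrimitive_iff.2 ⟨Q.act γ, (QF.scale_act p Q γ).symm⟩ hprim

lemma memF_one_scale_iff {N p D₀ r₀ D r : ℤ} (hp : p ≠ 0) (hcop : IsCoprime (2 * N) p) (Q : QF) :
    memF N p 1 D₀ r₀ D r (Q.scale p) ↔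
      Q.disc = D₀ * D ∧ (2 * N) ∣ (Q.b + r₀ * r) ∧ (N * p) ∣ Q.a := by
  rw [memF, QF.disc_scale]
  refine and_congr ?_ (and_congr ?_ ?_)
  · rw [mul_one, mul_assoc, mul_right_inj' (pow_ne_zero 2 hp)]
  · rw [show (Q.scale p).b + p ^ 1 * r₀ * r = p * (Q.b + r₀ * r) by simp only [QF.scale]; ring]
    exact ⟨hcop.dvd_of_dvd_mul_left, fun h ↦ h.mul_left p⟩
  · rw [show N * p ^ (2 * 1) = p * (N * p) by ring]
    exact mul_dvd_mul_iff_left hp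

/-- Assume `p ∤ D₀ D`. The map `[a,b,c] ↦ [pa, pb, pc]` induces a
well-defined bijection from the set of `Γ₀(Np)`-classes of forms with `b² - 4ac = D₀D`,
`b ≡ -r₀ r (mod 2N)` and `a ≡ 0 (mod Np)` onto the set of non-`p`-primitive classes in
`F^{(D,r)}_{D₀,r₀}(N,p)`. -/
theorem scale_bijection_onto_nonprimitive
    (N p D₀ r₀ D r : ℤ) (hN : 1 ≤ N) (hNodd : Odd N)
    (hp : Prime p) (hp5 : 5 ≤ p) (hpN : ¬ p ∣ N)
    (hD₀ : IsIndexPair N D₀ r₀) (hfund : IsFundamentalDiscriminant D₀)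
    (hD : IsIndexPair N D r) (hpD : ¬ p ∣ (D₀ * D)) :
    Set.BijOn (scaleClass (N * p) p)
      {cl : QFClass (N * p) | ∃ Q : QF, QFClass.mk (N * p) Q = cl ∧
        Q.disc = D₀ * D ∧ (2*N) ∣ (Q.b + r₀ * r) ∧ (N * p) ∣ Q.a}
      {cl ∈ Fclasses (N * p) N p 1 D₀ r₀ D r | ¬ pPrimClass (N * p) p cl} := by
  have hp0 : p ≠ 0 := hp.ne_zero
  have hcop : IsCoprime (2 * N) p := by
    refine ((Prime.coprime_iff_not_dvd hp).2 fun h ↦ ?_).symm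
    rcases hp.dvd_or_dvd h with h | h
    · exact absurd (Int.le_of_dvd two_pos h) (by lia)
    · exact hpN h
  refine ⟨?_, (scaleClass_injective _ hp0).injOn, ?_⟩
  · rintro _ ⟨Q, rfl, hQ⟩
    exact ⟨⟨Q.scale p, rfl, (memF_one_scale_iff hp0 hcop Q).2 hQ⟩,
      not_pPrimClass_scaleClass _ _ _⟩
  · rintro _ ⟨⟨Q, rfl, hQ⟩, hprim⟩
    obtain ⟨Q', rfl⟩ := QF.not_pPrimitive_iff.1 fun h ↦ hprim ⟨Q, rfl, h⟩
    exact ⟨QFClass.mk _ Q', ⟨Q', rfl, (memF_one_scale_iff hp0 hcop Q').1 hQ⟩, rfl⟩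
end
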